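/- arXiv:1508.06751 — 7 statements merged into one kernel-verified Lean document; each statement's English description precedes it below -/
import Mathlib

section
/- Let V : ℝ → ℝ be twice continuously differentiable and let c0 < c1 be real numbers such that every critical point c ∈ [c0,c1] of V (i.e. V'(c) = 0) satisfies V''(c) ≠ 0. Then there exist constants σ0 ∈ (0, (c1−c0)/2] and ρ0 > 0 such that: for every function x : G → ℝ with V'(x_g) = 0 and x_g ∈ [c0,c1] for all g ∈ G, every ρ ∈ [0, ρ0] and every subset B ⊆ G, there exists a unique function xρ : G → ℝ with sup_{g∈G} |xρ_g − x_g| ≤ σ0 satisfying ρ(Δxρ)_g − V'(xρ_g) = 0 for all g ∈ B^inn and xρ_g = x_g for all g ∈ G \ B^inn. Moreover, for every ε > 0 there exists ρ' ∈ (0, ρ0] such that whenever 0 ≤ ρ ≤ ρ', this xρ satisfies sup_{g∈G} |xρ_g − x_g| ≤ ε. -/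
open Finset Set Filter

/-- The discrete Laplacian on a group `G` with generating set `S`. -/
noncomputable def lap {G : Type*} [Group G] (S : Finset G) (x : G → ℝ) (g : G) : ℝ :=
  ∑ s ∈ S, (x (g * s) - x g)

/-- The inner set `B^inn` of a set `B ⊆ G`. -/
def innSet {G : Type*} [Group G] (S : Finset G) (B : Set G) : Set G :=
  {g ∈ B | ∀ s ∈ S, g * s ∈ B}

/-- The outer set `B^out` of a set `B ⊆ G`. -/
def outSet {G : Type*} [Group G] (S : Finset G) (B : Set G) : Set G :=
  B ∪ {g | ∃ s ∈ S, g * s ∈ B}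

/-- The Allen–Cahn action `W^ρ_Ω(x)`. -/
noncomputable def acAction {G : Type*} [Group G] (S : Finset G) (ρ : ℝ) (V : ℝ → ℝ)
    (Ω : Finset G) (x : G → ℝ) : ℝ :=
  ∑ g ∈ Ω, ∑ s ∈ S, (ρ / 4 * (x (g * s) - x g) ^ 2 + V (x g))

/-- `x` is a minimiser on `B ⊆ G` for the Allen–Cahn action. -/
def IsMinimiser {G : Type*} [Group G] (S : Finset G) (ρ : ℝ) (V : ℝ → ℝ)
    (B : Set G) (x : G → ℝ) : Prop :=
  ∀ v : G → ℝ, (Function.support v).Finite → Function.support v ⊆ innSet S B →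
    ∀ Ω : Finset G, outSet S (Function.support v) ⊆ ↑Ω →
      acAction S ρ V Ω (x + v) ≥ acAction S ρ V Ω x

/-- The word metric on `G` given by the generating set `S`. -/
noncomputable def wordDist {G : Type*} [Group G] (S : Finset G) (g h : G) : ℕ :=
  sInf {n | ∃ l : List G, (∀ s ∈ l, s ∈ S) ∧ l.length = n ∧ l.prod = g⁻¹ * h}

/-- The word-metric ball of radius `N` around the identity. -/
noncomputable def wordBall {G : Type*} [Group G] (S : Finset G) (N : ℕ) : Set G :=
  {g | wordDist S 1 g ≤ N}

/-- Uniform quasi-Newton estimate near the nondegenerate critical points. -/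
lemma unif_newton (f : ℝ → ℝ) (K : Set ℝ) (hK : IsCompact K)
    (hf : ∀ c ∈ K, ∃ a, a ≠ 0 ∧ HasStrictDerivAt f a c) :
    ∃ M > (0 : ℝ), ∃ σ > (0 : ℝ), ∀ c ∈ K, ∃ b : ℝ, b ≠ 0 ∧ |b| ≤ M ∧
      ∀ u v, |u - c| ≤ σ → |v - c| ≤ σ → |(u - v) - b * (f u - f v)| ≤ 1 / 4 * |u - v| := by
  refine hK.induction_on (p := fun K => ∃ M > (0 : ℝ), ∃ σ > (0 : ℝ), ∀ c ∈ K,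
      ∃ b : ℝ, b ≠ 0 ∧ |b| ≤ M ∧ ∀ u v, |u - c| ≤ σ → |v - c| ≤ σ →
        |(u - v) - b * (f u - f v)| ≤ 1 / 4 * |u - v|) ?_ ?_ ?_ ?_
  · exact ⟨1, one_pos, 1, one_pos, by simp⟩
  · rintro s t hst ⟨M, hM, σ, hσ, h⟩
    exact ⟨M, hM, σ, hσ, fun c hc => h c (hst hc)⟩
  · rintro s t ⟨M, hM, σ, hσ, h⟩ ⟨M', hM', σ', hσ', h'⟩
    refine ⟨max M M', lt_max_of_lt_left hM, min σ σ', lt_min hσ hσ', ?_⟩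
    rintro c (hc | hc)
    · obtain ⟨b, hb, hbM, H⟩ := h c hc
      exact ⟨b, hb, hbM.trans (le_max_left _ _), fun u v hu hv =>
        H u v (hu.trans (min_le_left _ _)) (hv.trans (min_le_left _ _))⟩
    · obtain ⟨b, hb, hbM, H⟩ := h' c hc
      exact ⟨b, hb, hbM.trans (le_max_right _ _), fun u v hu hv =>
        H u v (hu.trans (min_le_right _ _)) (hv.trans (min_le_right _ _))⟩
  · intro c hc
    obtain ⟨a, ha, hd⟩ := hf c hc
    have hapos : 0 < |a| := abs_pos.2 ha
    have h1 := hd.isLittleO.def (show 0 < |a| / 4 by positivity)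
    obtain ⟨r, hr, H⟩ := Metric.eventually_nhds_iff.1 h1
    refine ⟨Metric.ball c (r / 2), mem_nhdsWithin_of_mem_nhds
      (Metric.ball_mem_nhds _ (by positivity)), |a|⁻¹, by positivity, r / 4, by positivity, ?_⟩
    intro d hdd
    refine ⟨a⁻¹, inv_ne_zero ha, by rw [abs_inv], ?_⟩
    intro u v hu hv
    rw [Metric.mem_ball, Real.dist_eq] at hdd
    have hy : dist (u, v) (c, c) < r := by
      rw [Prod.dist_eq, max_lt_iff]
      simp only [Real.dist_eq]
      constructor
      · have := abs_sub_le u d c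
        linarith
      · have := abs_sub_le v d c
        linarith
    have h2 := H hy
    simp only [Real.norm_eq_abs] at h2
    have h3 : (u - v) - a⁻¹ * (f u - f v) = -(a⁻¹ * (f u - f v - (u - v) * a)) := by
      field_simp
      ring
    rw [h3, abs_neg, abs_mul, abs_inv]
    calc |a|⁻¹ * |f u - f v - (u - v) * a| ≤ |a|⁻¹ * (|a| / 4 * |u - v|) := by
          gcongr
          simpa [mul_comm] using h2
      _ = 1 / 4 * |u - v| := by field_simp

lemma lap_sub_le {G : Type*} [Group G] (S : Finset G) (z w : G → ℝ) (D : ℝ)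
    (h : ∀ g, |z g - w g| ≤ D) (g : G) : |lap S z g - lap S w g| ≤ S.card * (2 * D) := by
  unfold lap
  rw [← Finset.sum_sub_distrib, ← nsmul_eq_mul]
  refine (Finset.abs_sum_le_sum_abs _ _).trans (Finset.sum_le_card_nsmul _ _ _ ?_)
  intro s _
  have h1 := abs_le.1 (h g)
  have h2 := abs_le.1 (h (g * s))
  rw [abs_le]
  constructor <;> linarith

lemma lap_le {G : Type*} [Group G] (S : Finset G) (x : G → ℝ) (c0 c1 : ℝ)
    (h : ∀ g, x g ∈ Set.Icc c0 c1) (g : G) : |lap S x g| ≤ S.card * (c1 - c0) := by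
  unfold lap
  rw [← nsmul_eq_mul]
  refine (Finset.abs_sum_le_sum_abs _ _).trans (Finset.sum_le_card_nsmul _ _ _ ?_)
  intro s _
  have h1 := h g
  have h2 := h (g * s)
  rw [abs_le]
  constructor <;> linarith [h1.1, h1.2, h2.1, h2.2]

open Classical in
/-- The quasi-Newton map. -/
noncomputable def newtonMap {G : Type*} [Group G] (S : Finset G) (f : ℝ → ℝ) (ρ : ℝ)
    (I : Set G) (b x z : G → ℝ) (g : G) : ℝ :=
  if g ∈ I then z g - b g * (f (z g) - ρ * lap S z g) else x g

lemma newton_fixed {G : Type*} [Group G] (S : Finset G) (f : ℝ → ℝ) (ρ : ℝ)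
    (I : Set G) (b x z : G → ℝ) (hb : ∀ g, b g ≠ 0) :
    newtonMap S f ρ I b x z = z ↔
      (∀ g ∈ I, ρ * lap S z g - f (z g) = 0) ∧ (∀ g ∉ I, z g = x g) := by
  constructor
  · intro h
    constructor
    · intro g hg
      have := congrFun h g
      simp only [newtonMap, hg, if_true] at this
      have h2 : b g * (f (z g) - ρ * lap S z g) = 0 := by linarith
      have h3 := (mul_eq_zero.1 h2).resolve_left (hb g)
      linarith
    · intro g hg
      have := congrFun h g
      simp only [newtonMap, hg, if_false] at this
      exact this.symm
  · rintro ⟨h1, h2⟩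
    funext g
    by_cases hg : g ∈ I
    · have h3 : f (z g) - ρ * lap S z g = 0 := by linarith [h1 g hg]
      simp [newtonMap, hg, h3]
    · simp [newtonMap, hg, h2 g hg]

lemma newton_contr {G : Type*} [Group G] (S : Finset G) (f : ℝ → ℝ) (ρ : ℝ)
    (I : Set G) (b x z w : G → ℝ) (M σ D : ℝ) (hM : 0 < M) (hbM : ∀ g, |b g| ≤ M)
    (H : ∀ g u v, |u - x g| ≤ σ → |v - x g| ≤ σ →
      |(u - v) - b g * (f u - f v)| ≤ 1 / 4 * |u - v|)
    (hρ : 0 ≤ ρ) (hρ8 : 8 * (M * (S.card + 1)) * ρ ≤ 1)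
    (hz : ∀ g, |z g - x g| ≤ σ) (hw : ∀ g, |w g - x g| ≤ σ)
    (hD : ∀ g, |z g - w g| ≤ D) (g : G) :
    |newtonMap S f ρ I b x z g - newtonMap S f ρ I b x w g| ≤ D / 2 := by
  have hD0 : 0 ≤ D := (abs_nonneg _).trans (hD g)
  by_cases hg : g ∈ I
  · simp only [newtonMap, hg, if_true]
    have h1 := H g _ _ (hz g) (hw g)
    have h2 := lap_sub_le S z w D hD g
    have h3 : |b g * (ρ * (lap S z g - lap S w g))| ≤ M * (ρ * (S.card * (2 * D))) := by
      rw [abs_mul, abs_mul, abs_of_nonneg hρ]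
      gcongr
      exact hbM g
    have h4 : M * (ρ * (S.card * (2 * D))) ≤ D / 4 := by
      have : 0 ≤ M * ρ * D := by positivity
      nlinarith [mul_le_mul_of_nonneg_right hρ8 hD0]
    have h5 := hD g
    calc _ = |((z g - w g) - b g * (f (z g) - f (w g)))
              + b g * (ρ * (lap S z g - lap S w g))| := by congr 1; ring
      _ ≤ _ := abs_add_le _ _
      _ ≤ D / 2 := by linarith
  · simp only [newtonMap, hg, if_false, sub_self, abs_zero]
    positivity

lemma newton_start {G : Type*} [Group G] (S : Finset G) (f : ℝ → ℝ) (ρ : ℝ)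
    (I : Set G) (b x : G → ℝ) (M c0 c1 : ℝ) (hM : 0 < M) (hbM : ∀ g, |b g| ≤ M)
    (hc : c0 < c1) (hx : ∀ g, x g ∈ Set.Icc c0 c1) (hfx : ∀ g, f (x g) = 0)
    (hρ : 0 ≤ ρ) (g : G) :
    |newtonMap S f ρ I b x x g - x g| ≤ (M * (S.card + 1)) * (c1 - c0) * ρ := by
  have hL : 0 < c1 - c0 := sub_pos.2 hc
  by_cases hg : g ∈ I
  · simp only [newtonMap, hg, if_true, hfx]
    have h2 := lap_le S x c0 c1 hx g
    calc _ = |b g * (ρ * lap S x g)| := by congr 1; ring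
      _ ≤ M * (ρ * (S.card * (c1 - c0))) := by
        rw [abs_mul, abs_mul, abs_of_nonneg hρ]
        gcongr
        exact hbM g
      _ ≤ _ := by
        have : 0 ≤ M * ρ * (c1 - c0) := by positivity
        nlinarith
  · simp only [newtonMap, hg, if_false, sub_self, abs_zero]
    positivity

lemma newton_tendsto {G : Type*} [Group G] (S : Finset G) (f : ℝ → ℝ) (hf : Continuous f) (ρ : ℝ)
    (I : Set G) (b x : G → ℝ) : Continuous (newtonMap S f ρ I b x) := by
  refine continuous_pi fun g => ?_
  by_cases hg : g ∈ I
  · simp only [newtonMap, hg, if_true, lap]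
    fun_prop
  · simp only [newtonMap, hg, if_false]
    fun_prop

/-- solutions of the Allen–Cahn equation near the anti-continuum limit
(theorem `ac_theorem` of the paper). -/
theorem allenCahn_anticontinuum_limit
    {G : Type*} [Group G] (S : Finset G)
    (hSsymm : ∀ s ∈ S, s⁻¹ ∈ S) (hSone : (1 : G) ∉ S)
    (V : ℝ → ℝ) (hV : ContDiff ℝ 2 V)
    (c0 c1 : ℝ) (hc : c0 < c1)
    (hMorse : ∀ c ∈ Set.Icc c0 c1, deriv V c = 0 → deriv (deriv V) c ≠ 0) :
    ∃ σ0 ρ0 : ℝ, 0 < σ0 ∧ σ0 ≤ (c1 - c0) / 2 ∧ 0 < ρ0 ∧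
      ∀ x : G → ℝ, (∀ g, deriv V (x g) = 0) → (∀ g, x g ∈ Set.Icc c0 c1) →
        ((∀ ρ ∈ Set.Icc (0 : ℝ) ρ0, ∀ B : Set G,
          ∃! xρ : G → ℝ,
            (∀ g, |xρ g - x g| ≤ σ0) ∧
            (∀ g ∈ innSet S B, ρ * lap S xρ g - deriv V (xρ g) = 0) ∧
            (∀ g ∉ innSet S B, xρ g = x g)) ∧
        (∀ ε > (0 : ℝ), ∃ ρ' : ℝ, 0 < ρ' ∧ ρ' ≤ ρ0 ∧
          ∀ ρ : ℝ, 0 ≤ ρ → ρ ≤ ρ' → ∀ B : Set G, ∀ xρ : G → ℝ,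
            (∀ g, |xρ g - x g| ≤ σ0) →
            (∀ g ∈ innSet S B, ρ * lap S xρ g - deriv V (xρ g) = 0) →
            (∀ g ∉ innSet S B, xρ g = x g) →
            ∀ g, |xρ g - x g| ≤ ε)) := by
  have hV1 : ContDiff ℝ 1 (deriv V) := by
    have : ContDiff ℝ (1 + 1) V := by
      norm_num
      exact hV
    exact (contDiff_succ_iff_deriv.1 this).2.2
  set f := deriv V with hfdef
  have hfc : Continuous f := hV1.continuous
  have hK : IsCompact (Set.Icc c0 c1 ∩ f ⁻¹' {0}) :=
    isCompact_Icc.inter_right (isClosed_singleton.preimage hfc)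
  obtain ⟨M, hM, σ, hσ, hN⟩ := unif_newton f _ hK (by
    rintro c ⟨hc1, hc2⟩
    exact ⟨deriv f c, hMorse c hc1 hc2, hV1.contDiffAt.hasStrictDerivAt one_ne_zero⟩)
  have hL : 0 < c1 - c0 := sub_pos.2 hc
  obtain ⟨P, hPdef⟩ : ∃ P : ℝ, P = M * (S.card + 1) := ⟨_, rfl⟩
  have hP : 0 < P := by rw [hPdef]; positivity
  obtain ⟨τ, hτ, hτσ, hτL⟩ : ∃ τ > (0 : ℝ), τ ≤ σ ∧ τ ≤ (c1 - c0) / 2 :=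
    ⟨min σ ((c1 - c0) / 2), lt_min hσ (by positivity), min_le_left _ _, min_le_right _ _⟩
  obtain ⟨ρ0, hρ0, hρ1, hρ2⟩ : ∃ ρ0 > (0 : ℝ), 8 * P * ρ0 ≤ 1 ∧ P * (c1 - c0) * ρ0 ≤ τ / 2 := by
    refine ⟨min (1 / (8 * P)) (τ / 2 / (P * (c1 - c0))),
      lt_min (by positivity) (by positivity), ?_, ?_⟩
    · rw [mul_comm, ← le_div_iff₀ (by positivity)]
      exact min_le_left _ _
    · rw [mul_comm, ← le_div_iff₀ (by positivity)]
      exact min_le_right _ _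
  refine ⟨τ, ρ0, hτ, hτL, hρ0, ?_⟩
  intro x hfx hx
  have hN' := fun g => hN (x g) ⟨hx g, hfx g⟩
  choose b hb0 hbM H0 using hN'
  have H : ∀ g u v, |u - x g| ≤ τ → |v - x g| ≤ τ →
      |(u - v) - b g * (f u - f v)| ≤ 1 / 4 * |u - v| :=
    fun g u v hu hv => H0 g u v (hu.trans hτσ) (hv.trans hτσ)
  have hxx : ∀ g, |x g - x g| ≤ τ := fun g => by simp [hτ.le]
  have contr : ∀ ρ, 0 ≤ ρ → ρ ≤ ρ0 → ∀ I : Set G, ∀ z w : G → ℝ, (∀ g, |z g - x g| ≤ τ) →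
      (∀ g, |w g - x g| ≤ τ) → ∀ D, (∀ g, |z g - w g| ≤ D) → ∀ g,
      |newtonMap S f ρ I b x z g - newtonMap S f ρ I b x w g| ≤ D / 2 := by
    intro ρ h0 h1 I z w hz hw D hD
    refine newton_contr S f ρ I b x z w M τ D hM hbM H h0 ?_ hz hw hD
    rw [← hPdef]
    exact le_trans (by gcongr) hρ1
  have start : ∀ ρ, 0 ≤ ρ → ∀ I : Set G, ∀ g,
      |newtonMap S f ρ I b x x g - x g| ≤ P * (c1 - c0) * ρ := by
    intro ρ h0 I g
    rw [hPdef]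
    exact newton_start S f ρ I b x M c0 c1 hM hbM hc hx hfx h0 g
  have hpow : ∀ C : ℝ, Tendsto (fun n : ℕ => C * (1 / 2 : ℝ) ^ n) atTop (nhds 0) := by
    intro C
    simpa using (tendsto_pow_atTop_nhds_zero_of_lt_one
      (show (0 : ℝ) ≤ 1 / 2 by norm_num) (by norm_num)).const_mul C
  constructor
  · rintro ρ ⟨h0, h1⟩ B
    set T := newtonMap S f ρ (innSet S B) b x with hT
    have hstart : ∀ g, |T x g - x g| ≤ τ / 2 := fun g =>
      (start ρ h0 _ g).trans (le_trans (by gcongr) hρ2)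
    have hself : ∀ z : G → ℝ, (∀ g, |z g - x g| ≤ τ) → ∀ g, |T z g - x g| ≤ τ := by
      intro z hz g
      have h2 := contr ρ h0 h1 (innSet S B) z x hz hxx τ hz g
      have h3 := hstart g
      have h4 := abs_sub_le (T z g) (T x g) (x g)
      linarith
    obtain ⟨z, hz0, hzs⟩ : ∃ z : ℕ → G → ℝ, z 0 = x ∧ ∀ n, z (n + 1) = T (z n) :=
      ⟨fun n => T^[n] x, rfl, fun n => Function.iterate_succ_apply' T n x⟩
    have hzb : ∀ n g, |z n g - x g| ≤ τ := by
      intro n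
      induction n with
      | zero => rw [hz0]; exact hxx
      | succ n ih => rw [hzs]; exact hself _ ih
    have hzd : ∀ n g, |z (n + 1) g - z n g| ≤ τ * (1 / 2) ^ n := by
      intro n
      induction n with
      | zero =>
        intro g
        rw [hzs, hz0]
        have := hstart g
        simp only [pow_zero]
        linarith
      | succ n ih =>
        intro g
        rw [hzs (n + 1), hzs n]
        have := contr ρ h0 h1 (innSet S B) _ _ (hself _ (hzb n)) (hzb n) (τ * (1 / 2) ^ n)
          (by rw [← hzs]; exact ih) g
        rw [pow_succ]
        linarith
    have hlim : ∀ g, ∃ l, Tendsto (fun n => z n g) atTop (nhds l) := by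
      intro g
      apply cauchySeq_tendsto_of_complete
      refine cauchySeq_of_le_geometric (1 / 2) τ (by norm_num) fun n => ?_
      rw [dist_comm, Real.dist_eq]
      exact hzd n g
    choose y hy using hlim
    have hyt : Tendsto z atTop (nhds y) := tendsto_pi_nhds.2 hy
    have hyfix : T y = y := by
      have e1 : Tendsto (fun n => T (z n)) atTop (nhds (T y)) :=
        ((newton_tendsto S f hfc ρ (innSet S B) b x).tendsto y).comp hyt
      have e2 : Tendsto (fun n => T (z n)) atTop (nhds y) := by
        simp only [← hzs]
        exact (tendsto_add_atTop_iff_nat 1).2 hyt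
      exact tendsto_nhds_unique e1 e2
    have hyb : ∀ g, |y g - x g| ≤ τ := fun g =>
      le_of_tendsto ((hy g).sub_const (x g)).abs (Eventually.of_forall fun n => hzb n g)
    refine ⟨y, ⟨hyb, (newton_fixed S f ρ _ b x y hb0).1 hyfix⟩, ?_⟩
    rintro w ⟨hwb, hw⟩
    have hwfix : T w = w := (newton_fixed S f ρ _ b x w hb0).2 hw
    have hdist : ∀ n : ℕ, ∀ g, |w g - y g| ≤ (2 * τ) * (1 / 2) ^ n := by
      intro n
      induction n with
      | zero =>
        intro g
        have h2 := abs_le.1 (hwb g)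
        have h3 := abs_le.1 (hyb g)
        rw [pow_zero, abs_le]
        constructor <;> linarith
      | succ n ih =>
        intro g
        have := contr ρ h0 h1 (innSet S B) w y hwb hyb _ ih g
        rw [← hT, hwfix, hyfix] at this
        rw [pow_succ]
        linarith
    funext g
    have := ge_of_tendsto' (hpow (2 * τ)) fun n => hdist n g
    exact sub_eq_zero.1 (abs_nonpos_iff.1 this)
  · intro ε hε
    refine ⟨min ρ0 (ε / (2 * (P * (c1 - c0)))), lt_min hρ0 (by positivity), min_le_left _ _, ?_⟩
    intro ρ h0 h1 B w hwb hw1 hw2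
    have hwfix := (newton_fixed S f ρ (innSet S B) b x w hb0).2 ⟨hw1, hw2⟩
    have hη : 2 * (P * (c1 - c0) * ρ) ≤ ε := by
      have := h1.trans (min_le_right _ _)
      rw [le_div_iff₀ (by positivity)] at this
      linarith
    have hdist : ∀ n : ℕ, ∀ g, |w g - x g| ≤ τ * (1 / 2) ^ n + ε := by
      intro n
      induction n with
      | zero =>
        intro g
        rw [pow_zero]
        linarith [hwb g]
      | succ n ih =>
        intro g
        have h2 := contr ρ h0 (h1.trans (min_le_left _ _)) (innSet S B) w x hwb hxx _ ih g
        rw [hwfix] at h2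
        have h3 := start ρ h0 (innSet S B) g
        have h4 := abs_sub_le (w g) (newtonMap S f ρ (innSet S B) b x x g) (x g)
        rw [pow_succ]
        linarith
    intro g
    have := ge_of_tendsto' ((hpow τ).add_const ε) fun n => hdist n g
    simpa using this
end

section
/- Let V : ℝ → ℝ be any function, ρ ≥ 0, and let B ⊆ G be a finite set. For any two functions x, y : G → ℝ, let M := max{x, y} and m := min{x, y} be their pointwise maximum and minimum. Then W^ρ_B(x) + W^ρ_B(y) ≥ W^ρ_B(M) + W^ρ_B(m). -/
open Finset Set Filter

/-- Pointwise form of the submodularity inequality. -/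
theorem quad_min_max (ρ : ℝ) (V : ℝ → ℝ) (hρ : 0 ≤ ρ) (a b c d : ℝ) :
    (ρ / 4 * (max a c - max b d) ^ 2 + V (max b d)) +
      (ρ / 4 * (min a c - min b d) ^ 2 + V (min b d)) ≤
    (ρ / 4 * (a - b) ^ 2 + V b) + (ρ / 4 * (c - d) ^ 2 + V d) := by
  rcases le_total a c with h1 | h1 <;> rcases le_total b d with h2 | h2 <;>
    simp only [max_eq_left, max_eq_right, min_eq_left, min_eq_right, h1, h2] <;>
    nlinarith [mul_nonneg hρ (mul_nonneg (sub_nonneg.2 h1) (sub_nonneg.2 h2))]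

/-- the Allen–Cahn action is submodular with respect to pointwise
maximum and minimum (lemma `mm_lemma` of the paper). -/
theorem allenCahn_action_min_max
    {G : Type*} [Group G] (S : Finset G)
    (hSsymm : ∀ s ∈ S, s⁻¹ ∈ S) (hSone : (1 : G) ∉ S)
    (V : ℝ → ℝ) (ρ : ℝ) (hρ : 0 ≤ ρ)
    (B : Finset G) (x y : G → ℝ) :
    acAction S ρ V B x + acAction S ρ V B y ≥
      acAction S ρ V B (fun g => max (x g) (y g)) +
      acAction S ρ V B (fun g => min (x g) (y g)) := by
  unfold acAction
  rw [ge_iff_le, ← Finset.sum_add_distrib, ← Finset.sum_add_distrib]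
  refine Finset.sum_le_sum fun g _ => ?_
  rw [← Finset.sum_add_distrib, ← Finset.sum_add_distrib]
  exact Finset.sum_le_sum fun s _ => quad_min_max ρ V hρ _ _ _ _
end

section
/- Let V : ℝ → ℝ be differentiable, let ρ > 0, and suppose S generates G. If x, y : G → ℝ are global minimisers (for parameter ρ) with x_g ≤ y_g for all g ∈ G and x ≠ y, then x_g < y_g for all g ∈ G. -/
open Finset Set Filter

open Classical in
/-- Weak Euler-Lagrange equation at a site `g`, tested against the indicator of `g`. -/
theorem euler_lagrange_weak {G : Type*} [Group G] (S : Finset G)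
    (V : ℝ → ℝ) (hV : Differentiable ℝ V) (ρ : ℝ) (x : G → ℝ)
    (hx : IsMinimiser S ρ V Set.univ x) (g : G) (Ω : Finset G)
    (hΩ : outSet S {g} ⊆ (Ω : Set G)) (d : G → ℝ) (hd : ∀ h, d h = if h = g then 1 else 0) :
    ∑ h ∈ Ω, ∑ s ∈ S, (ρ / 2 * (x (h * s) - x h) * (d (h * s) - d h)
      + deriv V (x h) * d h) = 0 := by
  have hder : HasDerivAt (fun t : ℝ => acAction S ρ V Ω (x + t • d))
      (∑ h ∈ Ω, ∑ s ∈ S, (ρ / 2 * (x (h * s) - x h) * (d (h * s) - d h)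
      + deriv V (x h) * d h)) 0 := by
    unfold acAction
    refine HasDerivAt.fun_sum fun h _ => HasDerivAt.fun_sum fun s _ => ?_
    have lin : ∀ k, HasDerivAt (fun t : ℝ => (x + t • d) k) (d k) 0 := by
      intro k
      simpa using ((hasDerivAt_id (0 : ℝ)).mul_const (d k)).const_add (x k)
    have h1 := (((lin (h * s)).sub (lin h)).pow 2).const_mul (ρ / 4)
    have hVx : HasDerivAt V (deriv V (x h)) ((x + (0 : ℝ) • d) h) := by
      simpa using (hV (x h)).hasDerivAt
    have h2 := HasDerivAt.comp (0 : ℝ) hVx (lin h)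
    convert h1.add h2 using 1
    · rfl
    · simp
      ring
  have hmin : IsLocalMin (fun t : ℝ => acAction S ρ V Ω (x + t • d)) 0 := by
    refine Filter.Eventually.of_forall fun t => ?_
    have hsub : Function.support (t • d) ⊆ {g} := by
      intro h hh
      by_contra hne
      apply hh
      have : h ≠ g := hne
      simp [hd, this]
    have := hx (t • d) ((Set.finite_singleton g).subset hsub)
      (fun h _ => ⟨trivial, fun _ _ => trivial⟩) Ω (by
        refine Set.Subset.trans ?_ hΩ
        rintro h (hh | ⟨s, hs, hh⟩)
        · exact Or.inl (hsub hh)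
        · exact Or.inr ⟨s, hs, hsub hh⟩)
    simpa using this
  exact hmin.hasDerivAt_eq_zero hder

open Classical in
/-- Contact at `g` propagates to neighbours. -/
theorem contact_propagates {G : Type*} [Group G] (S : Finset G) (hSone : (1 : G) ∉ S)
    (V : ℝ → ℝ) (hV : Differentiable ℝ V) (ρ : ℝ) (hρ : 0 < ρ) (x y : G → ℝ)
    (hx : IsMinimiser S ρ V Set.univ x) (hy : IsMinimiser S ρ V Set.univ y)
    (hle : ∀ g, x g ≤ y g) (g : G) (hg : x g = y g) (s : G) (hs : s ∈ S) :
    x (g * s) = y (g * s) := by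
  let Ω : Finset G := insert g (S.image fun s => g * s⁻¹)
  have hΩ : outSet S {g} ⊆ (Ω : Set G) := by
    rintro h (hh | ⟨s, hs, hh⟩)
    · have : h = g := hh
      simp [Ω, this]
    · have : h * s = g := hh
      simp only [Ω, Finset.coe_insert, Finset.coe_image]
      exact Or.inr ⟨s, hs, by simp [← this]⟩
  let d : G → ℝ := fun h => if h = g then 1 else 0
  have ex := euler_lagrange_weak S V hV ρ x hx g Ω hΩ d (fun _ => rfl)
  have ey := euler_lagrange_weak S V hV ρ y hy g Ω hΩ d (fun _ => rfl)
  have e : ∑ h ∈ Ω, ∑ s ∈ S,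
      (ρ / 2 * ((x (h * s) - y (h * s)) - (x h - y h)) * (d (h * s) - d h)) = 0 := by
    rw [← sub_self (0 : ℝ)]
    nth_rewrite 1 [← ex]
    rw [← ey, ← Finset.sum_sub_distrib]
    refine Finset.sum_congr rfl fun h _ => ?_
    rw [← Finset.sum_sub_distrib]
    refine Finset.sum_congr rfl fun s _ => ?_
    have : deriv V (x h) * d h = deriv V (y h) * d h := by
      by_cases hh : h = g
      · rw [hh, hg]
      · simp [d, hh]
    rw [this]
    ring
  have nn : ∀ h, ∀ s ∈ S,
      0 ≤ ρ / 2 * ((x (h * s) - y (h * s)) - (x h - y h)) * (d (h * s) - d h) := by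
    intro h s hs
    have hs1 : s ≠ 1 := fun h1 => hSone (h1 ▸ hs)
    by_cases h1 : h = g
    · subst h1
      have := hle (h * s)
      simp only [d, mul_eq_left, hs1, if_true, if_false]
      nlinarith
    · by_cases h2 : h * s = g
      · have := hle h
        simp only [d, h1, h2, if_true, if_false, hg]
        nlinarith
      · simp [d, h1, h2]
  rw [Finset.sum_eq_zero_iff_of_nonneg
    (fun h _ => Finset.sum_nonneg (nn h))] at e
  have e1 := e g (by simp [Ω])
  rw [Finset.sum_eq_zero_iff_of_nonneg (nn g)] at e1
  have e2 := e1 s hs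
  have hs1 : s ≠ 1 := fun h1 => hSone (h1 ▸ hs)
  simp only [d, mul_eq_left, hs1, if_true, if_false, hg] at e2
  nlinarith [hle (g * s)]

/-- ordered distinct global minimisers are strictly ordered
(lemma `comparison` of the paper). -/
theorem allenCahn_global_minimisers_strictly_ordered
    {G : Type*} [Group G] (S : Finset G)
    (hSsymm : ∀ s ∈ S, s⁻¹ ∈ S) (hSone : (1 : G) ∉ S)
    (hSgen : Subgroup.closure (S : Set G) = ⊤)
    (V : ℝ → ℝ) (hV : Differentiable ℝ V)
    (ρ : ℝ) (hρ : 0 < ρ)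
    (x y : G → ℝ)
    (hx : IsMinimiser S ρ V Set.univ x) (hy : IsMinimiser S ρ V Set.univ y)
    (hle : ∀ g, x g ≤ y g) (hne : x ≠ y) :
    ∀ g, x g < y g := by
  intro g
  refine lt_of_le_of_ne (hle g) fun hg => hne ?_
  have key : ∀ k ∈ Subgroup.closure (S : Set G), ∀ h, x h = y h → x (h * k) = y (h * k) := by
    intro k hk
    induction hk using Subgroup.closure_induction'' with
    | mem s hs => exact fun h hh => contact_propagates S hSone V hV ρ hρ x y hx hy hle h hh s hs
    | inv_mem s hs =>
      exact fun h hh =>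
        contact_propagates S hSone V hV ρ hρ x y hx hy hle h hh s⁻¹ (hSsymm s hs)
    | one => intro h hh; simpa using hh
    | mul a b _ _ ha hb =>
      intro h hh
      rw [← mul_assoc]
      exact hb _ (ha _ hh)
  funext h
  simpa using key (g⁻¹ * h) (by rw [hSgen]; trivial) g hg
end

section
/- Let V : ℝ → ℝ be continuous with V(t) → ∞ as |t| → ∞, and let ρ ≥ 0. Let B ⊆ G be a finite set and let f : G → ℝ be any function. Then there exists a function x : G → ℝ which is a minimiser on B (for parameter ρ) and satisfies x_g = f_g for all g ∈ G \ B^inn. -/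
open Finset Set Filter

/-- existence of minimisers of the Dirichlet problem on finite sets
(lemma `existence_lemma` of the paper). -/
theorem allenCahn_existence_of_minimisers
    {G : Type*} [Group G] (S : Finset G)
    (hSsymm : ∀ s ∈ S, s⁻¹ ∈ S) (hSone : (1 : G) ∉ S)
    (V : ℝ → ℝ) (hV : Continuous V)
    (hVcoercive : Filter.Tendsto V (Filter.cocompact ℝ) Filter.atTop)
    (ρ : ℝ) (hρ : 0 ≤ ρ)
    (B : Set G) (hB : B.Finite) (f : G → ℝ) :
    ∃ x : G → ℝ, IsMinimiser S ρ V B x ∧ ∀ g ∉ innSet S B, x g = f g := by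
  classical
  rcases S.eq_empty_or_nonempty with hS | hS
  · subst hS
    exact ⟨f, fun v _ _ Ω _ => by simp [acAction], fun g _ => rfl⟩
  obtain ⟨t0, ht0⟩ := hV.exists_forall_le hVcoercive
  set F : Finset G := hB.toFinset with hF
  have hcard : (0 : ℝ) < S.card := by exact_mod_cast hS.card_pos
  set C : ℝ := acAction S ρ V F f / S.card - ∑ g ∈ F, V t0 + V t0 with hC
  have hcomp : IsCompact {t | V t ≤ C} := by
    obtain ⟨K, hK, hKs⟩ := mem_cocompact.1 (hVcoercive.eventually (eventually_gt_atTop C))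
    refine hK.of_isClosed_subset (isClosed_le hV continuous_const) ?_
    intro t ht
    by_contra hn
    have h1 : C < V t := hKs hn
    have h2 : V t ≤ C := ht
    linarith
  have key : ∀ x : G → ℝ, acAction S ρ V F x ≤ acAction S ρ V F f → ∀ g ∈ F, V (x g) ≤ C := by
    intro x hx g hg
    have h1 : S.card * ∑ g ∈ F, V (x g) ≤ acAction S ρ V F x := by
      unfold acAction
      rw [Finset.mul_sum]
      refine Finset.sum_le_sum fun g _ => ?_
      rw [← nsmul_eq_mul, ← Finset.sum_const]
      refine Finset.sum_le_sum fun s _ => ?_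
      have : 0 ≤ ρ / 4 * (x (g * s) - x g) ^ 2 := by positivity
      linarith
    have h2 : V (x g) - V t0 ≤ ∑ g ∈ F, (V (x g) - V t0) :=
      Finset.single_le_sum (f := fun g => V (x g) - V t0)
        (fun i _ => sub_nonneg.2 (ht0 (x i))) hg
    rw [Finset.sum_sub_distrib] at h2
    have h3 : ∑ g ∈ F, V (x g) ≤ acAction S ρ V F f / S.card := by
      rw [le_div_iff₀ hcard]
      linarith
    rw [hC]
    linarith
  set K : Set (G → ℝ) :=
    Set.pi Set.univ (fun g => if g ∈ innSet S B then {t | V t ≤ C} else {f g}) with hKdef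
  have hK : IsCompact K := by
    refine isCompact_univ_pi fun g => ?_
    split_ifs
    · exact hcomp
    · exact isCompact_singleton
  have hmem : ∀ x : G → ℝ, (∀ g ∉ innSet S B, x g = f g) →
      acAction S ρ V F x ≤ acAction S ρ V F f → x ∈ K := by
    intro x hx hle g _
    by_cases hg : g ∈ innSet S B
    · simp only [hg, if_true]
      exact key x hle g (by simpa [hF] using hg.1)
    · simp only [hg, if_false]
      exact hx g hg
  have hcont : Continuous (fun x : G → ℝ => acAction S ρ V F x) := by
    unfold acAction
    fun_prop
  have hfK : f ∈ K := hmem f (fun _ _ => rfl) le_rfl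
  obtain ⟨x, hxK, hmin⟩ := hK.exists_isMinOn ⟨f, hfK⟩ hcont.continuousOn
  have hxf : ∀ g ∉ innSet S B, x g = f g := by
    intro g hg
    have := hxK g (Set.mem_univ g)
    simpa only [hg, if_false, Set.mem_singleton_iff] using this
  refine ⟨x, ?_, hxf⟩
  intro v hvfin hv Ω hΩ
  have hglob : acAction S ρ V F x ≤ acAction S ρ V F (x + v) := by
    by_cases hle : acAction S ρ V F (x + v) ≤ acAction S ρ V F f
    · refine hmin (hmem (x + v) (fun g hg => ?_) hle)
      have hv0 : v g = 0 := by
        by_contra hne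
        exact hg (hv hne)
      simp [hv0, hxf g hg]
    · exact (hmin hfK).trans (not_le.1 hle).le
  -- the difference of the actions only sees `outSet S (support v)`
  let T : Finset G := Ω.filter (fun g => g ∈ outSet S (Function.support v))
  have hdiff : ∀ Λ : Finset G, T ⊆ Λ →
      acAction S ρ V Λ (x + v) - acAction S ρ V Λ x
        = acAction S ρ V T (x + v) - acAction S ρ V T x := by
    intro Λ hΛ
    unfold acAction
    rw [← Finset.sum_sub_distrib, ← Finset.sum_sub_distrib]
    symm
    refine Finset.sum_subset hΛ fun g _ hg => ?_
    have hgo : g ∉ outSet S (Function.support v) := fun h =>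
      hg (Finset.mem_filter.2 ⟨by exact_mod_cast hΩ h, h⟩)
    have h0 : v g = 0 := by
      by_contra hne
      exact hgo (Or.inl hne)
    rw [sub_eq_zero]
    refine Finset.sum_congr rfl fun s hs => ?_
    have h1 : v (g * s) = 0 := by
      by_contra hne
      exact hgo (Or.inr ⟨s, hs, hne⟩)
    simp [h0, h1]
  have hTF : T ⊆ F := by
    intro g hg
    have hgo := (Finset.mem_filter.1 hg).2
    rw [hF, Set.Finite.mem_toFinset]
    rcases hgo with h | ⟨s, hs, h⟩
    · exact (hv h).1
    · simpa using (hv h).2 s⁻¹ (hSsymm s hs)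
  have e1 := hdiff Ω (Finset.filter_subset _ _)
  have e2 := hdiff F hTF
  linarith
end

section
/- Let V : ℝ → ℝ be continuous and ρ ≥ 0. Let (B^n)_{n∈ℕ} be an increasing sequence of subsets of G with ⋃_n B^n = G, and for each n let x^n : G → ℝ be a minimiser on B^n (for parameter ρ). If x^n converges pointwise to a function x^∞ : G → ℝ, then x^∞ is a global minimiser. -/
open Finset Set Filter

/-- pointwise limits of minimisers on an exhausting sequence of sets
are global minimisers. -/
theorem allenCahn_limit_of_minimisers_is_global
    {G : Type*} [Group G] (S : Finset G)
    (hSsymm : ∀ s ∈ S, s⁻¹ ∈ S) (hSone : (1 : G) ∉ S)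
    (V : ℝ → ℝ) (hV : Continuous V)
    (ρ : ℝ) (hρ : 0 ≤ ρ)
    (B : ℕ → Set G) (hBmono : Monotone B) (hBunion : (⋃ n, B n) = Set.univ)
    (x : ℕ → G → ℝ) (hxmin : ∀ n, IsMinimiser S ρ V (B n) (x n))
    (xinf : G → ℝ)
    (hconv : ∀ g, Filter.Tendsto (fun n => x n g) Filter.atTop (nhds (xinf g))) :
    IsMinimiser S ρ V Set.univ xinf := by
  intro v hvfin _ Ω hΩ
  have hev : ∀ g : G, ∀ᶠ n in atTop, g ∈ B n := by
    intro g
    have hg : g ∈ ⋃ n, B n := by rw [hBunion]; trivial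
    obtain ⟨n, hn⟩ := Set.mem_iUnion.1 hg
    filter_upwards [eventually_ge_atTop n] with m hm using hBmono hm hn
  have hsub : ∀ᶠ n in atTop, Function.support v ⊆ innSet S (B n) := by
    have h : ∀ᶠ n in atTop, ∀ g ∈ Function.support v, g ∈ innSet S (B n) := by
      rw [hvfin.eventually_all]
      intro g _
      have h2 : ∀ᶠ n in atTop, ∀ s ∈ S, g * s ∈ B n := by
        rw [Finset.eventually_all]
        intro s _
        exact hev _
      filter_upwards [hev g, h2] with n h1 h2 using ⟨h1, h2⟩
    exact h
  have hlim : ∀ (y : ℕ → G → ℝ) (z : G → ℝ),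
      (∀ g, Filter.Tendsto (fun n => y n g) atTop (nhds (z g))) →
      Filter.Tendsto (fun n => acAction S ρ V Ω (y n)) atTop (nhds (acAction S ρ V Ω z)) := by
    intro y z h
    unfold acAction
    refine tendsto_finsetSum _ fun g _ => tendsto_finsetSum _ fun s _ => ?_
    exact ((((h (g * s)).sub (h g)).pow 2).const_mul _).add ((hV.tendsto _).comp (h g))
  refine le_of_tendsto_of_tendsto (hlim x xinf hconv)
    (hlim (fun n => x n + v) (xinf + v) fun g => (hconv g).add_const (v g)) ?_
  filter_upwards [hsub] with n hn using hxmin n v hvfin hn Ω hΩ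
end

section
/- Let V : ℝ → ℝ be twice continuously differentiable and let c0 < c1 be real numbers such that every critical point c ∈ [c0,c1] of V satisfies V''(c) ≠ 0. For every k ∈ (0,1) there exist constants σ0 > 0 and ρ0 > 0 such that for every function x : G → ℝ with V'(x_g) = 0 and x_g ∈ [c0,c1] for all g ∈ G, every subset B ⊆ G and every ρ ∈ [0, ρ0], the quasi-Newton map K defined by K(X)_g := X_g − (V'(X_g) + 𝟙[g ∈ B^inn]·ρ(ΔX)_g) / V''(x_g) satisfies: (i) whenever sup_{g∈G} |X_g − x_g| ≤ σ0, also sup_{g∈G} |K(X)_g − x_g| ≤ σ0; and (ii) whenever sup_{g∈G} |X_g − x_g| ≤ σ0 and sup_{g∈G} |Y_g − x_g| ≤ σ0, one has sup_{g∈G} |K(X)_g − K(Y)_g| ≤ k · sup_{g∈G} |X_g − Y_g|. -/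
open Finset Set Filter

/-- the quasi-Newton operator is a `k`-contraction mapping the
`σ0`-ball around an anti-continuum solution into itself (from the proof of theorem
`ac_theorem` of the paper). -/
theorem allenCahn_quasiNewton_contraction
    {G : Type*} [Group G] (S : Finset G)
    (hSsymm : ∀ s ∈ S, s⁻¹ ∈ S) (hSone : (1 : G) ∉ S)
    (V : ℝ → ℝ) (hV : ContDiff ℝ 2 V)
    (c0 c1 : ℝ) (hc : c0 < c1)
    (hMorse : ∀ c ∈ Set.Icc c0 c1, deriv V c = 0 → deriv (deriv V) c ≠ 0) :
    ∀ k : ℝ, 0 < k → k < 1 →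
    ∃ σ0 ρ0 : ℝ, 0 < σ0 ∧ 0 < ρ0 ∧
      ∀ x : G → ℝ, (∀ g, deriv V (x g) = 0) → (∀ g, x g ∈ Set.Icc c0 c1) →
      ∀ B : Set G, ∀ ρ ∈ Set.Icc (0 : ℝ) ρ0,
        -- the quasi-Newton operator `K`
        ∀ K : (G → ℝ) → (G → ℝ),
        (∀ X : G → ℝ, ∀ g : G, K X g = X g -
            (deriv V (X g) + (innSet S B).indicator (fun h => ρ * lap S X h) g) /
              deriv (deriv V) (x g)) →
        -- (i) `K` maps the `σ0`-ball around `x` into itself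
        (∀ X : G → ℝ, (∀ g, |X g - x g| ≤ σ0) → ∀ g, |K X g - x g| ≤ σ0) ∧
        -- (ii) `K` is a `k`-contraction on that ball (in the supremum norm)
        (∀ X Y : G → ℝ, (∀ g, |X g - x g| ≤ σ0) → (∀ g, |Y g - x g| ≤ σ0) →
          ∀ g, |K X g - K Y g| ≤ k * ⨆ h, |X h - Y h|) := by
  intro k hk hk1
  have hV1 : ContDiff ℝ 1 (deriv V) := by
    have h2 : ContDiff ℝ (1 + 1) V := by
      have : (1 + 1 : WithTop ℕ∞) = 2 := by norm_num
      rw [this]; exact hV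
    exact (contDiff_succ_iff_deriv.1 h2).2.2
  have hd : Differentiable ℝ (deriv V) := hV1.differentiable (by norm_num)
  have hcont : Continuous (deriv (deriv V)) := hV1.continuous_deriv (by norm_num)
  -- lower bound for the second derivative at the critical points
  obtain ⟨m, hm, hmb⟩ : ∃ m : ℝ, 0 < m ∧ ∀ c ∈ Set.Icc c0 c1, deriv V c = 0 →
      m ≤ |deriv (deriv V) c| := by
    have hcomp : IsCompact (Set.Icc c0 c1 ∩ {c | deriv V c = 0}) :=
      isCompact_Icc.inter_right (isClosed_eq hd.continuous continuous_const)
    rcases (Set.Icc c0 c1 ∩ {c | deriv V c = 0}).eq_empty_or_nonempty with he | hne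
    · refine ⟨1, one_pos, fun c h1 h2 => ?_⟩
      have : c ∈ (Set.Icc c0 c1 ∩ {c | deriv V c = 0}) := ⟨h1, h2⟩
      rw [he] at this
      exact this.elim
    · obtain ⟨c, hcm, hmin⟩ := hcomp.exists_isMinOn hne hcont.abs.continuousOn
      exact ⟨|deriv (deriv V) c|, abs_pos.2 (hMorse c hcm.1 hcm.2),
        fun c' h1 h2 => hmin ⟨h1, h2⟩⟩
  -- uniform continuity of the second derivative
  obtain ⟨σ, hσ, hσb⟩ : ∃ σ : ℝ, 0 < σ ∧ ∀ a ∈ Set.Icc c0 c1, ∀ b, |b - a| ≤ σ →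
      |deriv (deriv V) a - deriv (deriv V) b| ≤ k * m / 2 := by
    have huc := (isCompact_Icc (a := c0 - 1) (b := c1 + 1)).uniformContinuousOn_of_continuous
      hcont.continuousOn
    rw [Metric.uniformContinuousOn_iff_le] at huc
    obtain ⟨δ, hδ, h⟩ := huc (k * m / 2) (by positivity)
    refine ⟨min δ 1, lt_min hδ one_pos, fun a ha b hb => ?_⟩
    have hb1 := hb.trans (min_le_left _ _)
    have hb2 := abs_le.1 (hb.trans (min_le_right _ _))
    have := h a ⟨by linarith [ha.1], by linarith [ha.2]⟩ b
      ⟨by linarith [ha.1], by linarith [ha.2]⟩ (by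
        rw [Real.dist_eq, abs_sub_comm]; exact hb1)
    rwa [Real.dist_eq] at this
  set N : ℝ := (S.card : ℝ) with hN
  have hN0 : 0 ≤ N := by positivity
  have hcc : 0 < c1 - c0 := by linarith
  have hk1' : 0 < 1 - k := by linarith
  refine ⟨σ, min (k * m / (4 * (N + 1))) ((1 - k) * σ * m / ((N + 1) * (c1 - c0))), hσ,
    lt_min (by positivity) (by positivity), ?_⟩
  intro x hx hxI B ρ hρ K hK
  have hρ0 := hρ.1
  have hρ1 : ρ * (4 * (N + 1)) ≤ k * m :=
    (le_div_iff₀ (by positivity)).1 (hρ.2.trans (min_le_left _ _))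
  have hρ2 : ρ * ((N + 1) * (c1 - c0)) ≤ (1 - k) * σ * m :=
    (le_div_iff₀ (by positivity)).1 (hρ.2.trans (min_le_right _ _))
  have hlap : ∀ (Z : G → ℝ) (E : ℝ) (g : G), (∀ s, |Z (g * s) - Z g| ≤ E) →
      |lap S Z g| ≤ N * E := by
    intro Z E g h
    unfold lap
    refine (Finset.abs_sum_le_sum_abs _ _).trans ?_
    refine (Finset.sum_le_card_nsmul _ _ E (fun s _ => h s)).trans ?_
    rw [nsmul_eq_mul]
  have hind : ∀ (Z : G → ℝ) (g : G),
      |(innSet S B).indicator (fun h => ρ * lap S Z h) g| ≤ ρ * |lap S Z g| := by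
    intro Z g
    by_cases hg : g ∈ innSet S B
    · rw [Set.indicator_of_mem hg, abs_mul, abs_of_nonneg hρ0]
    · rw [Set.indicator_of_notMem hg, abs_zero]; positivity
  have key : ∀ (X Y : G → ℝ) (D : ℝ), (∀ g, |X g - x g| ≤ σ) → (∀ g, |Y g - x g| ≤ σ) →
      (∀ h, |X h - Y h| ≤ D) → ∀ g, |K X g - K Y g| ≤ k * D := by
    intro X Y D hX hY hD g
    have hD0 : 0 ≤ D := (abs_nonneg _).trans (hD g)
    set A := deriv (deriv V) (x g) with hA
    have hAm : m ≤ |A| := hmb _ (hxI g) (hx g)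
    have hA0 : A ≠ 0 := abs_pos.1 (hm.trans_le hAm)
    have hmv : |(A * X g - deriv V (X g)) - (A * Y g - deriv V (Y g))|
        ≤ k * m / 2 * |X g - Y g| := by
      have := (convex_closedBall (x g) σ).norm_image_sub_le_of_norm_hasDerivWithin_le
        (f := fun t => A * t - deriv V t) (f' := fun t => A * 1 - deriv (deriv V) t)
        (C := k * m / 2) (x := Y g) (y := X g)
        (fun t _ => (((hasDerivAt_id t).const_mul A).sub
          (hd t).hasDerivAt).hasDerivWithinAt)
        (fun t ht => by
          rw [mul_one, Real.norm_eq_abs]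
          exact hσb _ (hxI g) t (by
            rw [Metric.mem_closedBall, Real.dist_eq] at ht; exact ht))
        (by rw [Metric.mem_closedBall, Real.dist_eq]; exact hY g)
        (by rw [Metric.mem_closedBall, Real.dist_eq]; exact hX g)
      simpa only [Real.norm_eq_abs] using this
    have hlapsub : lap S X g - lap S Y g = lap S (fun h => X h - Y h) g := by
      unfold lap
      rw [← Finset.sum_sub_distrib]
      exact Finset.sum_congr rfl (fun s _ => by ring)
    have hI : (innSet S B).indicator (fun h => ρ * lap S X h) g
        - (innSet S B).indicator (fun h => ρ * lap S Y h) g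
        = (innSet S B).indicator (fun h => ρ * lap S (fun h => X h - Y h) h) g := by
      by_cases hg : g ∈ innSet S B
      · simp only [Set.indicator_of_mem hg]
        rw [← hlapsub]; ring
      · simp only [Set.indicator_of_notMem hg]; ring
    have hIb := hind (fun h => X h - Y h) g
    have hLb := hlap (fun h => X h - Y h) (2 * D) g (fun s => by
      have h1 := abs_le.1 (hD (g * s))
      have h2 := abs_le.1 (hD g)
      rw [abs_le]; constructor <;> linarith [h1.1, h1.2, h2.1, h2.2])
    have hIb2 := hIb.trans (mul_le_mul_of_nonneg_left hLb hρ0)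
    rw [← hI] at hIb2
    have heq : K X g - K Y g = ((A * X g - deriv V (X g)) - (A * Y g - deriv V (Y g))
        - ((innSet S B).indicator (fun h => ρ * lap S X h) g
        - (innSet S B).indicator (fun h => ρ * lap S Y h) g)) / A := by
      rw [hK X g, hK Y g, ← hA]
      field_simp
      ring
    rw [heq, abs_div, div_le_iff₀ (hm.trans_le hAm)]
    refine (abs_sub _ _).trans ?_
    have e1 : k * m / 2 * |X g - Y g| ≤ k * m / 2 * D :=
      mul_le_mul_of_nonneg_left (hD g) (by positivity)
    have e2 : k * D * m ≤ k * D * |A| := mul_le_mul_of_nonneg_left hAm (by positivity)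
    have e3 : ρ * (4 * (N + 1)) * D ≤ k * m * D := mul_le_mul_of_nonneg_right hρ1 hD0
    have e4 : 0 ≤ ρ * D := by positivity
    linarith
  refine ⟨fun X hX g => ?_, fun X Y hX hY g => ?_⟩
  · have h1 := key X x σ hX (fun g => by simpa using hσ.le) hX g
    have h2 : |K x g - x g| ≤ (1 - k) * σ := by
      have hAm := hmb _ (hxI g) (hx g)
      have hLb := hlap x (c1 - c0) g (fun s => by
        have h1 := hxI (g * s)
        have h2 := hxI g
        rw [abs_le]; constructor <;> linarith [h1.1, h1.2, h2.1, h2.2])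
      have hIb2 := (hind x g).trans (mul_le_mul_of_nonneg_left hLb hρ0)
      rw [hK x g, hx g, zero_add, sub_sub_cancel_left, abs_neg, abs_div,
        div_le_iff₀ (hm.trans_le hAm)]
      have e2 : (1 - k) * σ * m ≤ (1 - k) * σ * |deriv (deriv V) (x g)| :=
        mul_le_mul_of_nonneg_left hAm (by positivity)
      have e4 : 0 ≤ ρ * (c1 - c0) := by positivity
      linarith
    have h3 := abs_sub_le (K X g) (K x g) (x g)
    linarith
  · refine key X Y _ hX hY (fun h => ?_) g
    refine le_ciSup (f := fun h => |X h - Y h|) ⟨2 * σ, ?_⟩ h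
    rintro _ ⟨h, rfl⟩
    have h1 := abs_le.1 (hX h)
    have h2 := abs_le.1 (hY h)
    show |X h - Y h| ≤ 2 * σ
    rw [abs_le]; constructor <;> linarith [h1.1, h1.2, h2.1, h2.2]
end

section
/- Let V : ℝ → ℝ be twice continuously differentiable and let c0 < c1 be real numbers with V'(c0) = V'(c1) = 0 such that every critical point c ∈ [c0,c1] of V satisfies V''(c) ≠ 0. Then there exist constants σ0 > 0, ρ0 > 0 and k ∈ (0,1) such that the following holds for every ρ ∈ [0, ρ0] and every subset B ⊆ G. Let x : G → ℝ be a function with x_g ∈ {c0, c1} for all g ∈ G, and let xρ : G → ℝ be any function with sup_{g∈G} |xρ_g − x_g| ≤ σ0 which satisfies ρ(Δxρ)_g − V'(xρ_g) = 0 for all g ∈ B^inn and xρ_g = x_g for all g ∈ G \ B^inn. If g0 ∈ G and m ∈ ℕ are such that x_h = c0 for every h ∈ G with d(g0, h) ≤ m in the word metric, then |xρ_{g0} − c0| ≤ σ0 · k^m. -/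
open Finset Set Filter

/-- exponential decay of a continued solution towards `c0` on regions
where the anti-continuum solution equals `c0` (from the proof of theorem
`dirichlet` of the paper). -/
theorem allenCahn_exponential_decay
    {G : Type*} [Group G] (S : Finset G)
    (hSsymm : ∀ s ∈ S, s⁻¹ ∈ S) (hSone : (1 : G) ∉ S)
    (V : ℝ → ℝ) (hV : ContDiff ℝ 2 V)
    (c0 c1 : ℝ) (hc : c0 < c1)
    (hc0 : deriv V c0 = 0) (hc1 : deriv V c1 = 0)
    (hMorse : ∀ c ∈ Set.Icc c0 c1, deriv V c = 0 → deriv (deriv V) c ≠ 0) :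
    ∃ σ0 ρ0 k : ℝ, 0 < σ0 ∧ 0 < ρ0 ∧ 0 < k ∧ k < 1 ∧
      ∀ ρ ∈ Set.Icc (0 : ℝ) ρ0, ∀ B : Set G,
      ∀ x : G → ℝ, (∀ g, x g = c0 ∨ x g = c1) →
      ∀ xρ : G → ℝ,
        (∀ g, |xρ g - x g| ≤ σ0) →
        (∀ g ∈ innSet S B, ρ * lap S xρ g - deriv V (xρ g) = 0) →
        (∀ g ∉ innSet S B, xρ g = x g) →
        ∀ g0 : G, ∀ m : ℕ,
          (∀ h : G, wordDist S g0 h ≤ m → x h = c0) →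
          |xρ g0 - c0| ≤ σ0 * k ^ m := by
  have hd : HasDerivAt (deriv V) (deriv (deriv V) c0) c0 := by
    have h1 : ContDiff ℝ 1 (deriv V) := by
      have h2 : ContDiff ℝ (1 + 1) V := by
        simpa [one_add_one_eq_two] using hV
      exact (contDiff_succ_iff_deriv.1 h2).2.2
    exact ((h1.differentiable (by norm_num)) c0).hasDerivAt
  have ha : deriv (deriv V) c0 ≠ 0 := hMorse c0 ⟨le_refl _, hc.le⟩ hc0
  set a := deriv (deriv V) c0 with ha_def
  have hapos : 0 < |a| := abs_pos.2 ha
  have hev := (hasDerivAt_iff_isLittleO.1 hd).def (c := |a| / 2) (by positivity)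
  obtain ⟨ε, hε, hball⟩ := Metric.eventually_nhds_iff.1 hev
  have hlow : ∀ y : ℝ, |y - c0| ≤ ε / 2 → |a| / 2 * |y - c0| ≤ |deriv V y| := by
    intro y hy
    have h := @hball y (by rw [Real.dist_eq]; linarith)
    simp only [hc0, Real.norm_eq_abs, smul_eq_mul, sub_zero] at h
    have h3 : |(y - c0) * a| ≤ |deriv V y| + |deriv V y - (y - c0) * a| := by
      have := abs_sub (deriv V y) (deriv V y - (y - c0) * a)
      simpa using this
    rw [abs_mul] at h3
    nlinarith
  refine ⟨ε / 2, |a| / (8 * (S.card + 1)), 1 / 2, by positivity, by positivity, by norm_num,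
    by norm_num, ?_⟩
  intro ρ hρ B x hx xρ hclose hin hout
  have key : ∀ m : ℕ, ∀ g : G,
      (∀ l : List G, (∀ s ∈ l, s ∈ S) → l.length ≤ m → x (g * l.prod) = c0) →
      |xρ g - c0| ≤ ε / 2 * (1 / 2) ^ m := by
    intro m
    induction m with
    | zero =>
      intro g h
      have h0 : x g = c0 := by simpa using h [] (by simp) (by simp)
      have := hclose g
      rw [h0] at this
      simpa using this
    | succ m ih =>
      intro g h
      have h0 : x g = c0 := by simpa using h [] (by simp) (by simp)
      by_cases hg : g ∈ innSet S B
      · have hself := ih g (fun l hl hlen => h l hl (by omega))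
        have hnb : ∀ s ∈ S, |xρ (g * s) - c0| ≤ ε / 2 * (1 / 2) ^ m := by
          intro s hs
          refine ih (g * s) (fun l hl hlen => ?_)
          have := h (s :: l) (by simpa using ⟨hs, hl⟩) (by simpa using hlen)
          simpa [mul_assoc] using this
        set q : ℝ := ε / 2 * (1 / 2) ^ m with hq
        have hq0 : 0 ≤ q := by positivity
        have hlap : |lap S xρ g| ≤ S.card * (2 * q) := by
          unfold lap
          refine (Finset.abs_sum_le_sum_abs _ _).trans ?_
          refine (Finset.sum_le_card_nsmul S _ (2 * q) ?_).trans (by simp)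
          intro s hs
          have h1 := abs_le.1 (hnb s hs)
          have h2 := abs_le.1 hself
          exact abs_le.2 ⟨by linarith [h1.1, h2.2], by linarith [h1.2, h2.1]⟩
        have heq : deriv V (xρ g) = ρ * lap S xρ g := by linarith [hin g hg]
        have hl := hlow (xρ g) (by have := hclose g; rwa [h0] at this)
        rw [heq, abs_mul, abs_of_nonneg hρ.1] at hl
        have hρn : ρ * (8 * (S.card + 1)) ≤ |a| := by
          have := hρ.2
          rwa [le_div_iff₀ (by positivity)] at this
        have h5 : ρ * |lap S xρ g| ≤ ρ * (S.card * (2 * q)) :=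
          mul_le_mul_of_nonneg_left hlap hρ.1
        have h6 : ρ * (8 * (S.card + 1)) * q ≤ |a| * q :=
          mul_le_mul_of_nonneg_right hρn hq0
        have h7 : 0 ≤ ρ * q := mul_nonneg hρ.1 hq0
        have h8 : |a| * |xρ g - c0| ≤ |a| * (q * (1 / 2)) := by
          have h9 : 0 ≤ |a| * q := by positivity
          nlinarith
        have h10 := le_of_mul_le_mul_left h8 hapos
        rw [pow_succ, ← mul_assoc]
        exact h10
      · rw [hout g hg, h0]
        simp only [sub_self, abs_zero]
        positivity
  intro g0 m hm
  refine key m g0 (fun l hl hlen => hm _ ?_)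
  refine le_trans (Nat.sInf_le ⟨l, hl, rfl, by simp⟩) hlen
end
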